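/- Let G=(V,w,m) be a locally finite, connected, complete weighted graph with non-degenerate vertex measure, satisfying the curvature dimension condition CD(K,n) for some K>0 and n<∞, and with Deg_max < ∞. Then for all vertices x₀, y₀ ∈ V, the resistance distance satisfies ρ(x₀,y₀) ≤ √(n/K) · ( arcsin( 1/√(Kn/(2·Deg(x₀)) + 1) ) + arcsin( 1/√(Kn/(2·Deg(y₀)) + 1) ) ). -/

import Mathlib

open Filter
open scoped ENNReal

variable {V : Type*}

/-- The degree `deg(x) = ∑_y w(x,y)` of a vertex in a locally finite weighted graph. -/
noncomputable def vertexDeg (w : V → V → ℝ) (x : V) : ℝ := ∑' y, w x y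

/-- The normalized degree `Deg(x) = deg(x)/m(x)`. -/
noncomputable def nDeg (w : V → V → ℝ) (m : V → ℝ) (x : V) : ℝ := vertexDeg w x / m x

/-- The graph Laplacian `Δf(x) = (1/m(x)) ∑_y w(x,y)(f(y) - f(x))`. -/
noncomputable def graphLap (w : V → V → ℝ) (m : V → ℝ) (f : V → ℝ) (x : V) : ℝ :=
  (1 / m x) * ∑' y, w x y * (f y - f x)

/-- The Bakry–Émery operator `Γ`, defined by `2Γ(f,g) = Δ(fg) - fΔg - gΔf`. -/
noncomputable def bakryGamma (w : V → V → ℝ) (m : V → ℝ) (f g : V → ℝ) (x : V) : ℝ :=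
  (graphLap w m (fun z => f z * g z) x - f x * graphLap w m g x - g x * graphLap w m f x) / 2

/-- The carré du champ `Γf(x) = (1/(2m(x))) ∑_y w(x,y)(f(y) - f(x))²`, valued in `[0,∞]`
so that it is meaningful (possibly infinite) for every function `f`. -/
noncomputable def carre (w : V → V → ℝ) (m : V → ℝ) (f : V → ℝ) (x : V) : ℝ≥0∞ :=
  (∑' y, ENNReal.ofReal (w x y * (f y - f x) ^ 2)) / ENNReal.ofReal (2 * m x)

/-- `p` is a walk of length `k` from `x` to `y` along edges of positive weight. -/
def IsWalk (w : V → V → ℝ) (x y : V) (k : ℕ) (p : ℕ → V) : Prop :=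
  p 0 = x ∧ p k = y ∧ ∀ i < k, 0 < w (p i) (p (i + 1))

/-- Connectedness of a weighted graph: any two vertices are joined by a finite path of
consecutive neighbors. -/
def GraphConnected (w : V → V → ℝ) : Prop := ∀ x y : V, ∃ k p, IsWalk w x y k p

/-- The combinatorial distance: the minimal length of a path of consecutive neighbors. -/
noncomputable def combDist (w : V → V → ℝ) (x y : V) : ℕ :=
  sInf {k : ℕ | ∃ p, IsWalk w x y k p}

/-- The resistance distance `ρ(x,y) = sup {|f(y) - f(x)| : ‖Γf‖_∞ ≤ 1}`. -/
noncomputable def resistDist (w : V → V → ℝ) (m : V → ℝ) (x y : V) : ℝ :=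
  sSup {r : ℝ | ∃ f : V → ℝ, (∀ z, carre w m f z ≤ 1) ∧ r = |f y - f x|}

/-- The maximal normalized degree `Deg_max = sup_x deg(x)/m(x)`. -/
noncomputable def nDegMax (w : V → V → ℝ) (m : V → ℝ) : ℝ :=
  sSup (Set.range fun x : V => nDeg w m x)

/-- The iterated Bakry–Émery operator `Γ₂`, defined by
`2Γ₂(f,g) = ΔΓ(f,g) - Γ(f,Δg) - Γ(g,Δf)`. -/
noncomputable def bakryGamma2 (w : V → V → ℝ) (m : V → ℝ) (f g : V → ℝ) (x : V) : ℝ :=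
  (graphLap w m (bakryGamma w m f g) x - bakryGamma w m f (graphLap w m g) x
    - bakryGamma w m g (graphLap w m f) x) / 2

/-- The curvature dimension condition `CD(K,n)`: `Γ₂(f) ≥ (1/n)(Δf)² + KΓf` pointwise. -/
def CDCond (w : V → V → ℝ) (m : V → ℝ) (K n : ℝ) : Prop :=
  ∀ f : V → ℝ, ∀ x : V,
    (1 / n) * (graphLap w m f x) ^ 2 + K * bakryGamma w m f f x ≤ bakryGamma2 w m f f x

/-- Completeness of a weighted graph: there is a nondecreasing sequence of finitely supported
`[0,1]`-valued functions `η_k` converging pointwise to `1` with `Γ η_k ≤ 1/(k+1)` pointwise. -/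
def GraphComplete (w : V → V → ℝ) (m : V → ℝ) : Prop :=
  ∃ η : ℕ → V → ℝ,
    (∀ k x, η k x ∈ Set.Icc (0 : ℝ) 1) ∧
    (∀ k, (Function.support (η k)).Finite) ∧
    (∀ x, Monotone fun k => η k x) ∧
    (∀ x, Filter.Tendsto (fun k => η k x) Filter.atTop (nhds 1)) ∧
    (∀ k x, bakryGamma w m (η k) (η k) x ≤ 1 / (k + 1))

/-- Non-degeneracy of the vertex measure: `inf_x m(x) > 0`. -/
def NondegMeasure (m : V → ℝ) : Prop := ∃ c : ℝ, 0 < c ∧ ∀ x, c ≤ m x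

section Semigroup

variable {F : Type*} [NormedAddCommGroup F] [NormedSpace ℝ F]

/-- The semigroup `exp (t L)` generated by a bounded operator `L`. -/
noncomputable def heatSemigroup (L : F →L[ℝ] F) (t : ℝ) : F →L[ℝ] F :=
  NormedSpace.exp (t • L)

theorem heatSemigroup_zero (L : F →L[ℝ] F) : heatSemigroup L 0 = 1 := by
  rw [heatSemigroup, zero_smul, NormedSpace.exp_zero]

theorem heatSemigroup_apply_comm (L : F →L[ℝ] F) (t : ℝ) (f : F) :
    heatSemigroup L t (L f) = L (heatSemigroup L t f) := by
  have h : Commute L (heatSemigroup L t) :=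
    Commute.exp_right ((Commute.refl L).smul_right t)
  exact (congrArg (fun A : F →L[ℝ] F => A f) h.eq).symm

variable [CompleteSpace F]

theorem hasDerivAt_heatSemigroup (L : F →L[ℝ] F) (t : ℝ) :
    HasDerivAt (heatSemigroup L) (heatSemigroup L t * L) t :=
  hasDerivAt_exp_smul_const (𝕂 := ℝ) L t

theorem heatSemigroup_add (L : F →L[ℝ] F) (s t : ℝ) :
    heatSemigroup L (s + t) = heatSemigroup L s * heatSemigroup L t := by
  let _ : NormedAlgebra ℚ (F →L[ℝ] F) := NormedAlgebra.restrictScalars ℚ ℝ _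
  rw [heatSemigroup, add_smul]
  exact NormedSpace.exp_add_of_commute (((Commute.refl L).smul_right t).smul_left s)

theorem hasDerivAt_heatSemigroup_apply (L : F →L[ℝ] F) (f : F) (t : ℝ) :
    HasDerivAt (fun s => heatSemigroup L s f) (L (heatSemigroup L t f)) t := by
  have h := (hasDerivAt_heatSemigroup L t).clm_apply (hasDerivAt_const t f)
  simpa [heatSemigroup_apply_comm] using h

end Semigroup

section BoundedGenerator

variable {X E : Type*} [NormedCommRing E] [NormedAlgebra ℝ E]

/-- The carré du champ of a bounded operator `L` on a commutative Banach algebra. -/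
noncomputable def boundedGamma (L : E →L[ℝ] E) (f g : E) : E :=
  (1 / 2 : ℝ) • (L (f * g) - f * L g - g * L f)

/-- The iterated carré du champ of a bounded operator `L` on a commutative Banach algebra. -/
noncomputable def boundedGamma2 (L : E →L[ℝ] E) (f g : E) : E :=
  (1 / 2 : ℝ) • (L (boundedGamma L f g) - boundedGamma L f (L g) - boundedGamma L g (L f))

theorem HasDerivAt.continuousAlgHom_apply (χ : E →A[ℝ] ℝ) {u : ℝ → E} {u' : E} {t : ℝ}
    (h : HasDerivAt u u' t) : HasDerivAt (fun s => χ (u s)) (χ u') t :=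
  ContinuousLinearMap.hasFDerivAt
    (⟨(χ : E →ₐ[ℝ] ℝ).toLinearMap, χ.continuous⟩ : E →L[ℝ] ℝ) |>.comp_hasDerivAt t h

theorem hasDerivAt_boundedGamma (L : E →L[ℝ] E) {u : ℝ → E} {u' : E} {t : ℝ}
    (h : HasDerivAt u u' t) :
    HasDerivAt (fun s => boundedGamma L (u s) (u s)) ((2 : ℝ) • boundedGamma L (u t) u') t := by
  have h1 := L.hasFDerivAt.comp_hasDerivAt t (h.mul h)
  have h2 := h.mul (L.hasFDerivAt.comp_hasDerivAt t h)
  refine (((h1.sub h2).sub h2).const_smul (1 / 2 : ℝ)).congr_deriv ?_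
  simp only [boundedGamma, map_add, Function.comp_apply, mul_comm u' (u t), mul_comm u' (L (u t))]
  module

variable [CompleteSpace E]

theorem heatSemigroup_one {L : E →L[ℝ] E} (hL : L 1 = 0) (t : ℝ) :
    heatSemigroup L t 1 = 1 := by
  have hd : ∀ s, HasDerivAt (fun s => heatSemigroup L s 1) 0 s := fun s => by
    simpa [← heatSemigroup_apply_comm, hL] using hasDerivAt_heatSemigroup_apply L 1 s
  have := is_const_of_deriv_eq_zero (fun s => (hd s).differentiableAt) (fun s => (hd s).deriv) t 0
  simpa [heatSemigroup_zero] using this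

theorem exp_apply_nonneg (ev : X → E →A[ℝ] ℝ) {T : E →L[ℝ] E}
    (hT : ∀ f : E, (∀ x, 0 ≤ ev x f) → ∀ x, 0 ≤ ev x (T f))
    {f : E} (hf : ∀ x, 0 ≤ ev x f) (x : X) :
    0 ≤ ev x (NormedSpace.exp T f) := by
  have hpow : ∀ k : ℕ, ∀ x, 0 ≤ ev x ((T ^ k) f) := by
    intro k
    induction k with
    | zero => simpa using hf
    | succ k ih => rw [pow_succ']; exact hT _ ih
  have h := ((NormedSpace.exp_series_hasSum_exp' (𝕂 := ℝ) T).mapL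
    (ContinuousLinearMap.apply ℝ E f)).map (ev x) (ev x).continuous
  refine h.nonneg fun k => ?_
  have := hpow k x
  simp only [Function.comp_apply, map_smul, ContinuousLinearMap.apply_apply, smul_eq_mul]
  positivity

theorem heatSemigroup_nonneg (ev : X → E →A[ℝ] ℝ) {L : E →L[ℝ] E} {D : ℝ}
    (hL : ∀ f : E, (∀ x, 0 ≤ ev x f) → ∀ x, 0 ≤ ev x (L f) + D * ev x f)
    {t : ℝ} (ht : 0 ≤ t) {f : E} (hf : ∀ x, 0 ≤ ev x f) (x : X) :
    0 ≤ ev x (heatSemigroup L t f) := by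
  let _ : NormedAlgebra ℚ (E →L[ℝ] E) := NormedAlgebra.restrictScalars ℚ ℝ _
  have hexp : heatSemigroup L t = Real.exp (-(t * D)) • NormedSpace.exp (t • (L + D • 1)) := by
    have h1 : t • L = algebraMap ℝ _ (-(t * D)) + t • (L + D • 1) := by
      rw [Algebra.algebraMap_eq_smul_one]; module
    rw [heatSemigroup, h1, NormedSpace.exp_add_of_commute (Algebra.commutes _ _),
      ← NormedSpace.algebraMap_exp_comm, ← Real.exp_eq_exp_ℝ, Algebra.algebraMap_eq_smul_one,
      smul_one_mul]
  rw [hexp, smul_apply, map_smul]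
  refine mul_nonneg (Real.exp_pos _).le (exp_apply_nonneg ev (fun g hg y => ?_) hf x)
  have := mul_nonneg ht (hL g hg y)
  simpa [mul_add] using this

theorem heatSemigroup_mono (ev : X → E →A[ℝ] ℝ) {L : E →L[ℝ] E} {D : ℝ}
    (hL : ∀ f : E, (∀ x, 0 ≤ ev x f) → ∀ x, 0 ≤ ev x (L f) + D * ev x f)
    {t : ℝ} (ht : 0 ≤ t) {f g : E} (hfg : ∀ x, ev x f ≤ ev x g) (x : X) :
    ev x (heatSemigroup L t f) ≤ ev x (heatSemigroup L t g) := by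
  have := heatSemigroup_nonneg ev hL ht (f := g - f) (fun x => by simpa using hfg x) x
  simpa using this

theorem sq_heatSemigroup_le (ev : X → E →A[ℝ] ℝ) {L : E →L[ℝ] E} {D : ℝ}
    (hL : ∀ f : E, (∀ x, 0 ≤ ev x f) → ∀ x, 0 ≤ ev x (L f) + D * ev x f) (hL1 : L 1 = 0)
    {t : ℝ} (ht : 0 ≤ t) (f : E) (x : X) :
    (ev x (heatSemigroup L t f)) ^ 2 ≤ ev x (heatSemigroup L t (f * f)) := by
  set c := ev x (heatSemigroup L t f) with hc
  have h := heatSemigroup_nonneg ev hL ht (f := f * f - (2 * c) • f + c ^ 2 • (1 : E))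
    (fun y => by
      simp only [map_add, map_sub, map_mul, map_smul, map_one, smul_eq_mul]
      nlinarith [sq_nonneg (ev y f - c)]) x
  simp only [map_add, map_sub, map_smul, map_one, heatSemigroup_one hL1, smul_eq_mul, ← hc] at h
  linarith

/-- The Bakry–Émery gradient estimate for the semigroup of a bounded Markov generator. -/
theorem boundedGamma_heatSemigroup_le (ev : X → E →A[ℝ] ℝ) {L : E →L[ℝ] E} {D K n : ℝ}
    (hL : ∀ f : E, (∀ x, 0 ≤ ev x f) → ∀ x, 0 ≤ ev x (L f) + D * ev x f) (hL1 : L 1 = 0)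
    (hK : 0 < K) (hn : 0 < n)
    (hCD : ∀ (f : E) x, (1 / n) * (ev x (L f)) ^ 2 + K * ev x (boundedGamma L f f)
      ≤ ev x (boundedGamma2 L f f))
    {t : ℝ} (ht : 0 ≤ t) (f : E) (x : X) :
    ev x (boundedGamma L (heatSemigroup L t f) (heatSemigroup L t f))
        + (1 - Real.exp (-2 * K * t)) / (K * n) * (ev x (L (heatSemigroup L t f))) ^ 2
      ≤ Real.exp (-2 * K * t) * ev x (heatSemigroup L t (boundedGamma L f f)) := by
  set c := (ev x (L (heatSemigroup L t f))) ^ 2 with hc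
  set u : ℝ → E := fun s => heatSemigroup L (t - s) f with hu
  set F : ℝ → ℝ := fun s => ev x (heatSemigroup L s (boundedGamma L (u s) (u s))) with hF
  have hu' : ∀ s, HasDerivAt u (-L (u s)) s := fun s => by
    have h := (hasDerivAt_heatSemigroup_apply L f (t - s)).scomp s
      ((hasDerivAt_id s).const_sub t)
    rw [neg_one_smul] at h
    exact h
  have hF' : ∀ s, HasDerivAt F
      (ev x (heatSemigroup L s ((2 : ℝ) • boundedGamma2 L (u s) (u s)))) s := by
    intro s
    have h := ((hasDerivAt_heatSemigroup L s).clm_apply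
      (hasDerivAt_boundedGamma L (hu' s))).continuousAlgHom_apply (ev x)
    refine h.congr_deriv ?_
    have e : (2 : ℝ) • boundedGamma2 L (u s) (u s)
        = L (boundedGamma L (u s) (u s)) + (2 : ℝ) • boundedGamma L (u s) (-L (u s)) := by
      simp only [boundedGamma2, boundedGamma, map_neg, mul_neg, neg_mul]
      module
    rw [e, map_add (heatSemigroup L s)]
    rfl
  have hbound : ∀ s, 0 ≤ s → 2 * K * F s + 2 / n * c
      ≤ ev x (heatSemigroup L s ((2 : ℝ) • boundedGamma2 L (u s) (u s))) := by
    intro s hs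
    have h1 := heatSemigroup_mono ev hL hs
      (f := (2 / n) • (L (u s) * L (u s)) + (2 * K) • boundedGamma L (u s) (u s))
      (g := (2 : ℝ) • boundedGamma2 L (u s) (u s)) (fun y => by
        have h := hCD (u s) y
        simp only [map_add, map_smul, map_mul, smul_eq_mul]
        calc _ = 2 * (1 / n * (ev y (L (u s))) ^ 2 + K * ev y (boundedGamma L (u s) (u s))) := by
              ring
          _ ≤ _ := by linarith) x
    refine le_trans ?_ h1
    have e : L (heatSemigroup L t f) = heatSemigroup L s (L (u s)) := by
      rw [heatSemigroup_apply_comm, hu]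
      have := heatSemigroup_add L s (t - s)
      rw [add_sub_cancel] at this
      rw [this]; rfl
    have h2 := sq_heatSemigroup_le ev hL hL1 hs (L (u s)) x
    rw [← e, ← hc] at h2
    have h3 : 2 / n * c ≤ 2 / n * ev x (heatSemigroup L s (L (u s) * L (u s))) := by gcongr
    simp only [map_add, map_smul, smul_eq_mul, hF]
    linarith
  have hexp : ∀ s, HasDerivAt (fun s => Real.exp (-2 * K * s))
      (Real.exp (-2 * K * s) * (-2 * K)) s := fun s => by
    simpa using ((hasDerivAt_id s).const_mul (-2 * K)).exp
  have hh : ∀ s, HasDerivAt (fun s => Real.exp (-2 * K * s) * (F s + c / (K * n)))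
      (Real.exp (-2 * K * s) * (-2 * K) * (F s + c / (K * n)) + Real.exp (-2 * K * s) *
        ev x (heatSemigroup L s ((2 : ℝ) • boundedGamma2 L (u s) (u s)))) s := fun s =>
    (hexp s).mul ((hF' s).add_const _)
  have hmono : MonotoneOn (fun s => Real.exp (-2 * K * s) * (F s + c / (K * n))) (Set.Ici 0) := by
    refine monotoneOn_of_deriv_nonneg (convex_Ici 0)
      (fun s _ => (hh s).continuousAt.continuousWithinAt)
      (fun s _ => (hh s).differentiableAt.differentiableWithinAt) fun s hs => ?_
    rw [interior_Ici] at hs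
    rw [(hh s).deriv]
    have h1 := hbound s (le_of_lt hs)
    have e : K * (c / (K * n)) = c / n := by field_simp
    have e2 : Real.exp (-2 * K * s) * (-2 * K) * (F s + c / (K * n)) + Real.exp (-2 * K * s) *
        ev x (heatSemigroup L s ((2 : ℝ) • boundedGamma2 L (u s) (u s))) = Real.exp (-2 * K * s) *
        (ev x (heatSemigroup L s ((2 : ℝ) • boundedGamma2 L (u s) (u s))) - 2 * K * F s
          - 2 * (K * (c / (K * n)))) := by ring
    rw [e2, e]
    have e3 : 2 / n * c = 2 * (c / n) := by ring
    exact mul_nonneg (Real.exp_pos _).le (by linarith)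
  have hfin := hmono (Set.mem_Ici.2 le_rfl) (Set.mem_Ici.2 ht) ht
  simp only [hF, hu, sub_zero, sub_self, heatSemigroup_zero, mul_zero, Real.exp_zero, one_mul,
    one_apply_eq_self] at hfin
  have e : (1 - Real.exp (-2 * K * t)) / (K * n) * c
    = c / (K * n) - Real.exp (-2 * K * t) * (c / (K * n)) := by ring
  rw [e]
  linarith

theorem heatSemigroup_apply_le_exp (ev : X → E →A[ℝ] ℝ) {L : E →L[ℝ] E} {D K n : ℝ}
    (hL : ∀ f : E, (∀ x, 0 ≤ ev x f) → ∀ x, 0 ≤ ev x (L f) + D * ev x f) (hL1 : L 1 = 0)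
    (hK : 0 < K) (hn : 0 < n)
    (hCD : ∀ (f : E) x, (1 / n) * (ev x (L f)) ^ 2 + K * ev x (boundedGamma L f f)
      ≤ ev x (boundedGamma2 L f f))
    {t : ℝ} (ht : 0 ≤ t) {f : E} (hf : ∀ x, ev x (boundedGamma L f f) ≤ 1) (x : X) :
    ev x (boundedGamma L (heatSemigroup L t f) (heatSemigroup L t f))
        + (1 - Real.exp (-2 * K * t)) / (K * n) * (ev x (L (heatSemigroup L t f))) ^ 2
      ≤ Real.exp (-2 * K * t) := by
  refine (boundedGamma_heatSemigroup_le ev hL hL1 hK hn hCD ht f x).trans ?_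
  have h := heatSemigroup_mono ev hL ht (f := boundedGamma L f f) (g := 1)
    (fun y => by simpa using hf y) x
  rw [heatSemigroup_one hL1, map_one] at h
  exact mul_le_of_le_one_right (Real.exp_pos _).le h

theorem hasDerivAt_arcsin_exp {K a : ℝ} (hK : 0 < K) (ha : 1 < a) {t : ℝ} (ht : 0 ≤ t) :
    HasDerivAt (fun s => Real.arcsin (Real.exp (-K * s) / a))
      (-(K * Real.exp (-K * t) / √(a ^ 2 - Real.exp (-K * t) ^ 2))) t := by
  have ha0 : 0 < a := zero_lt_one.trans ha
  have hq : Real.exp (-K * t) ≤ 1 := Real.exp_le_one_iff.2 (by nlinarith)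
  have hq0 := Real.exp_pos (-K * t)
  have hlt : Real.exp (-K * t) / a < 1 := (div_lt_one ha0).2 (hq.trans_lt ha)
  have hpos : 0 < Real.exp (-K * t) / a := by positivity
  have h1 : HasDerivAt (fun s => Real.exp (-K * s) / a) (Real.exp (-K * t) * (-K) / a) t := by
    simpa using (((hasDerivAt_id t).const_mul (-K)).exp).div_const a
  refine ((Real.hasDerivAt_arcsin (by linarith) hlt.ne).comp t h1).congr_deriv ?_
  have e : 1 - (Real.exp (-K * t) / a) ^ 2 = (a ^ 2 - Real.exp (-K * t) ^ 2) / a ^ 2 := by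
    field_simp
  have hS : 0 < √(a ^ 2 - Real.exp (-K * t) ^ 2) := Real.sqrt_pos.2 (by nlinarith)
  rw [e, Real.sqrt_div' _ (by positivity), Real.sqrt_sq ha0.le]
  field_simp

/-- The heat flow moves a function with `Γ f ≤ 1` at a point of degree `d` by at most the
arcsine term of the diameter bound. -/
theorem heatSemigroup_sub_le (ev : X → E →A[ℝ] ℝ) {L : E →L[ℝ] E} {D K n : ℝ}
    (hL : ∀ f : E, (∀ x, 0 ≤ ev x f) → ∀ x, 0 ≤ ev x (L f) + D * ev x f) (hL1 : L 1 = 0)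
    (hK : 0 < K) (hn : 0 < n)
    (hCD : ∀ (f : E) x, (1 / n) * (ev x (L f)) ^ 2 + K * ev x (boundedGamma L f f)
      ≤ ev x (boundedGamma2 L f f))
    {x : X} {d : ℝ} (hd : 0 < d)
    (hx : ∀ f : E, (ev x (L f)) ^ 2 ≤ 2 * d * ev x (boundedGamma L f f))
    {t : ℝ} (ht : 0 ≤ t) {f : E} (hf : ∀ x, ev x (boundedGamma L f f) ≤ 1) :
    ev x (heatSemigroup L t f) - ev x f
      ≤ √(n / K) * Real.arcsin (1 / √(K * n / (2 * d) + 1)) := by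
  set A := K * n / (2 * d) + 1 with hA
  have hA1 : 1 < A := by have : 0 < K * n / (2 * d) := by positivity
                         linarith
  have hA2 : √A ^ 2 = A := Real.sq_sqrt (by linarith)
  have ha : 1 < √A := Real.lt_sqrt_of_sq_lt (by linarith)
  have hder : ∀ s, 0 ≤ s → HasDerivAt
      (fun s => ev x (heatSemigroup L s f) + √(n / K) * Real.arcsin (Real.exp (-K * s) / √A))
      (ev x (L (heatSemigroup L s f)) + √(n / K) *
        (-(K * Real.exp (-K * s) / √(√A ^ 2 - Real.exp (-K * s) ^ 2)))) s := fun s hs =>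
    ((hasDerivAt_heatSemigroup_apply L f s).continuousAlgHom_apply (ev x)).add
      ((hasDerivAt_arcsin_exp hK ha hs).const_mul _)
  have hanti : AntitoneOn (fun s => ev x (heatSemigroup L s f)
      + √(n / K) * Real.arcsin (Real.exp (-K * s) / √A)) (Set.Ici 0) := by
    refine antitoneOn_of_deriv_nonpos (convex_Ici 0)
      (fun s hs => (hder s hs).continuousAt.continuousWithinAt)
      (fun s hs => (hder s (interior_subset hs)).differentiableAt.differentiableWithinAt)
      fun s hs => ?_
    have hs0 : 0 ≤ s := interior_subset hs
    rw [(hder s hs0).deriv]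
    set q := Real.exp (-K * s) with hq
    have hq0 : 0 < q := Real.exp_pos _
    have hq1 : q ≤ 1 := Real.exp_le_one_iff.2 (by nlinarith)
    have hqq : Real.exp (-2 * K * s) = q ^ 2 := by
      rw [hq, ← Real.exp_nat_mul]; congr 1; push_cast; ring
    have hqA : 0 < A - q ^ 2 := by nlinarith
    set b := ev x (L (heatSemigroup L s f)) with hb
    have h1 := heatSemigroup_apply_le_exp ev hL hL1 hK hn hCD hs0 hf x
    have h2 := hx (heatSemigroup L s f)
    rw [← hb, hqq] at h1
    rw [← hb] at h2
    have h3 : b ^ 2 / (2 * d) ≤ ev x (boundedGamma L (heatSemigroup L s f)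
        (heatSemigroup L s f)) := by
      rw [div_le_iff₀ (by positivity)]; linarith
    have h4 : b ^ 2 * (A - q ^ 2) ≤ K * n * q ^ 2 := by
      have : b ^ 2 / (2 * d) + (1 - q ^ 2) / (K * n) * b ^ 2 ≤ q ^ 2 := by linarith
      calc b ^ 2 * (A - q ^ 2)
          = K * n * (b ^ 2 / (2 * d) + (1 - q ^ 2) / (K * n) * b ^ 2) := by
            rw [hA]; field_simp; ring
        _ ≤ K * n * q ^ 2 := by gcongr
    have h5 : b ≤ √(n / K) * (K * q / √(√A ^ 2 - q ^ 2)) := by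
      refine le_of_sq_le_sq ?_ (by positivity)
      rw [mul_pow, div_pow, hA2, Real.sq_sqrt hqA.le, Real.sq_sqrt (by positivity)]
      calc b ^ 2 ≤ K * n * q ^ 2 / (A - q ^ 2) := (le_div_iff₀ hqA).2 h4
        _ = _ := by field_simp
    linarith
  have h := hanti (Set.mem_Ici.2 le_rfl) (Set.mem_Ici.2 ht) ht
  simp only [mul_zero, Real.exp_zero, heatSemigroup_zero, one_apply_eq_self] at h
  have h0 : 0 ≤ √(n / K) * Real.arcsin (Real.exp (-K * t) / √A) :=
    mul_nonneg (Real.sqrt_nonneg _) (Real.arcsin_nonneg.2 (by positivity))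
  linarith

theorem abs_heatSemigroup_sub_le (ev : X → E →A[ℝ] ℝ) {L : E →L[ℝ] E} {D K n : ℝ}
    (hL : ∀ f : E, (∀ x, 0 ≤ ev x f) → ∀ x, 0 ≤ ev x (L f) + D * ev x f) (hL1 : L 1 = 0)
    (hK : 0 < K) (hn : 0 < n)
    (hCD : ∀ (f : E) x, (1 / n) * (ev x (L f)) ^ 2 + K * ev x (boundedGamma L f f)
      ≤ ev x (boundedGamma2 L f f))
    {x : X} {d : ℝ} (hd : 0 < d)
    (hx : ∀ f : E, (ev x (L f)) ^ 2 ≤ 2 * d * ev x (boundedGamma L f f))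
    {t : ℝ} (ht : 0 ≤ t) {f : E} (hf : ∀ x, ev x (boundedGamma L f f) ≤ 1) :
    |ev x (heatSemigroup L t f) - ev x f|
      ≤ √(n / K) * Real.arcsin (1 / √(K * n / (2 * d) + 1)) := by
  have hneg : boundedGamma L (-f) (-f) = boundedGamma L f f := by
    simp [boundedGamma]
  have h := heatSemigroup_sub_le ev hL hL1 hK hn hCD hd hx ht (f := -f)
    (fun y => by rw [hneg]; exact hf y)
  rw [map_neg, map_neg, map_neg] at h
  exact abs_le.2 ⟨by linarith, heatSemigroup_sub_le ev hL hL1 hK hn hCD hd hx ht hf⟩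

end BoundedGenerator

section WeightedGraph

theorem summable_weight_mul {w : V → V → ℝ} (hnonneg : ∀ x y, 0 ≤ w x y)
    (hlocfin : ∀ x, Summable fun y => w x y) {a : V → ℝ} {C : ℝ} (ha : ∀ y, |a y| ≤ C) (x : V) :
    Summable fun y => w x y * a y := by
  refine Summable.of_norm_bounded ((hlocfin x).mul_right C) fun y => ?_
  rw [norm_mul, Real.norm_of_nonneg (hnonneg x y)]
  exact mul_le_mul_of_nonneg_left (ha y) (hnonneg x y)

theorem summable_weight_mul_sub {w : V → V → ℝ} (hnonneg : ∀ x y, 0 ≤ w x y)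
    (hlocfin : ∀ x, Summable fun y => w x y) {f : V → ℝ} {C : ℝ} (hf : ∀ y, |f y| ≤ C) (x : V) :
    Summable fun y => w x y * (f y - f x) :=
  summable_weight_mul hnonneg hlocfin (C := 2 * C)
    (fun y => (abs_sub _ _).trans (by linarith [hf y, hf x])) x

theorem summable_weight_mul_sub_sq {w : V → V → ℝ} (hnonneg : ∀ x y, 0 ≤ w x y)
    (hlocfin : ∀ x, Summable fun y => w x y) {f : V → ℝ} {C : ℝ} (hf : ∀ y, |f y| ≤ C) (x : V) :
    Summable fun y => w x y * (f y - f x) ^ 2 := by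
  refine summable_weight_mul hnonneg hlocfin (C := (2 * C) ^ 2) (fun y => ?_) x
  rw [abs_pow]
  exact pow_le_pow_left₀ (abs_nonneg _) ((abs_sub _ _).trans (by linarith [hf y, hf x])) 2

theorem graphLap_eq {w : V → V → ℝ} (m : V → ℝ) (hnonneg : ∀ x y, 0 ≤ w x y)
    (hlocfin : ∀ x, Summable fun y => w x y) {f : V → ℝ} {C : ℝ} (hf : ∀ y, |f y| ≤ C) (x : V) :
    graphLap w m f x = (1 / m x) * ∑' y, w x y * f y - nDeg w m x * f x := by
  simp only [graphLap, nDeg, vertexDeg, mul_sub]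
  rw [(summable_weight_mul hnonneg hlocfin hf x).tsum_sub ((hlocfin x).mul_right _), tsum_mul_right]
  ring

theorem bakryGamma_self_eq {w : V → V → ℝ} (m : V → ℝ) (hnonneg : ∀ x y, 0 ≤ w x y)
    (hlocfin : ∀ x, Summable fun y => w x y) {f : V → ℝ} {C : ℝ} (hf : ∀ y, |f y| ≤ C) (x : V) :
    bakryGamma w m f f x = (∑' y, w x y * (f y - f x) ^ 2) / (2 * m x) := by
  have h1 := summable_weight_mul_sub hnonneg hlocfin hf x
  have h2 := summable_weight_mul_sub_sq hnonneg hlocfin hf x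
  have e : ∑' y, w x y * (f y * f y - f x * f x)
      = ∑' y, w x y * (f y - f x) ^ 2 + (2 * f x) * ∑' y, w x y * (f y - f x) := by
    rw [← tsum_mul_left, ← h2.tsum_add (h1.mul_left _)]
    exact tsum_congr fun y => by ring
  simp only [bakryGamma, graphLap]
  rw [e]
  ring

theorem sq_graphLap_le {w : V → V → ℝ} {m : V → ℝ} (hnonneg : ∀ x y, 0 ≤ w x y)
    (hm : ∀ x, 0 < m x) (hlocfin : ∀ x, Summable fun y => w x y) {f : V → ℝ} {C : ℝ}
    (hf : ∀ y, |f y| ≤ C) {x : V} (hx : 0 < nDeg w m x) :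
    (graphLap w m f x) ^ 2 ≤ 2 * nDeg w m x * bakryGamma w m f f x := by
  have h1 := summable_weight_mul_sub hnonneg hlocfin hf x
  have h2 := summable_weight_mul_sub_sq hnonneg hlocfin hf x
  rw [bakryGamma_self_eq m hnonneg hlocfin hf]
  have hmx := hm x
  have hdeg : 0 < vertexDeg w x := (div_pos_iff_of_pos_right hmx).1 hx
  simp only [graphLap, nDeg]
  set S := ∑' y, w x y * (f y - f x) with hS
  set Q := ∑' y, w x y * (f y - f x) ^ 2 with hQ
  set c := S / vertexDeg w x with hc
  have hpos : 0 ≤ ∑' y, w x y * (f y - f x - c) ^ 2 :=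
    tsum_nonneg fun y => mul_nonneg (hnonneg x y) (sq_nonneg _)
  have e : ∑' y, w x y * (f y - f x - c) ^ 2 = Q - 2 * c * S + c ^ 2 * vertexDeg w x := by
    rw [hQ, hS, vertexDeg, ← tsum_mul_left, ← tsum_mul_left, ← h2.tsum_sub (h1.mul_left _),
      ← (h2.sub (h1.mul_left _)).tsum_add ((hlocfin x).mul_left _)]
    exact tsum_congr fun y => by ring
  have e2 : Q - 2 * c * S + c ^ 2 * vertexDeg w x = Q - S ^ 2 / vertexDeg w x := by
    rw [hc]; field_simp; ring
  rw [e, e2, sub_nonneg, div_le_iff₀ hdeg] at hpos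
  calc (1 / m x * S) ^ 2 = S ^ 2 / m x ^ 2 := by ring
    _ ≤ Q * vertexDeg w x / m x ^ 2 := by gcongr
    _ = _ := by field_simp

theorem bakryGamma_le_one_of_carre_le_one {w : V → V → ℝ} {m : V → ℝ}
    (hnonneg : ∀ x y, 0 ≤ w x y) (hm : ∀ x, 0 < m x) (hlocfin : ∀ x, Summable fun y => w x y)
    {f : V → ℝ} {C : ℝ} (hf : ∀ y, |f y| ≤ C) {x : V} (h : carre w m f x ≤ 1) :
    bakryGamma w m f f x ≤ 1 := by
  have hmx := hm x
  have h2 := summable_weight_mul_sub_sq hnonneg hlocfin hf x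
  rw [carre, ← ENNReal.ofReal_tsum_of_nonneg
    (fun y => mul_nonneg (hnonneg x y) (sq_nonneg _)) h2,
    ← ENNReal.ofReal_div_of_pos (by positivity), ENNReal.ofReal_le_one] at h
  rwa [bakryGamma_self_eq m hnonneg hlocfin hf]

theorem carre_mono {w : V → V → ℝ} (m : V → ℝ) (hnonneg : ∀ x y, 0 ≤ w x y) {f g : V → ℝ}
    {x : V} (h : ∀ y, |f y - f x| ≤ |g y - g x|) : carre w m f x ≤ carre w m g x := by
  refine ENNReal.div_le_div_right (ENNReal.tsum_le_tsum fun y => ENNReal.ofReal_le_ofReal ?_) _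
  exact mul_le_mul_of_nonneg_left (sq_le_sq.2 (h y)) (hnonneg x y)

theorem nDeg_pos {w : V → V → ℝ} {m : V → ℝ} (hnonneg : ∀ x y, 0 ≤ w x y)
    (hm : ∀ x, 0 < m x) (hlocfin : ∀ x, Summable fun y => w x y) (hconn : GraphConnected w)
    {x y : V} (hxy : x ≠ y) : 0 < nDeg w m x := by
  obtain ⟨k, p, h0, hk, hp⟩ := hconn x y
  have hk0 : 0 < k := Nat.pos_of_ne_zero fun h => hxy (by rw [← h0, ← hk, h])
  have hw := hp 0 hk0
  rw [h0] at hw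
  exact div_pos ((hlocfin x).tsum_pos (hnonneg x) _ hw) (hm x)

theorem sq_sub_le_of_bakryGamma_le {w : V → V → ℝ} {m : V → ℝ}
    (hnonneg : ∀ x y, 0 ≤ w x y) (hm : ∀ x, 0 < m x) (hlocfin : ∀ x, Summable fun y => w x y)
    {f : V → ℝ} {C : ℝ} (hf : ∀ y, |f y| ≤ C) {x y : V} (hxy : 0 < w x y) {ε : ℝ}
    (h : bakryGamma w m f f x ≤ ε) : (f y - f x) ^ 2 ≤ 2 * m x / w x y * ε := by
  have hmx := hm x
  have h2 := summable_weight_mul_sub_sq hnonneg hlocfin hf x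
  rw [bakryGamma_self_eq m hnonneg hlocfin hf, div_le_iff₀ (by positivity)] at h
  have h3 := h2.le_tsum y fun z _ => mul_nonneg (hnonneg x z) (sq_nonneg _)
  rw [div_mul_eq_mul_div, le_div_iff₀ hxy]
  linarith

/-- The Banach algebra of bounded real functions. -/
abbrev BoundedFun (V : Type*) : Type _ := lp (fun _ : V => ℝ) ⊤

namespace BoundedFun

theorem abs_apply_le (f : BoundedFun V) (x : V) : |f x| ≤ ‖f‖ :=
  lp.norm_apply_le_norm ENNReal.top_ne_zero f x

/-- A function with an explicit bound, as an element of the algebra of bounded functions. -/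
def ofBound (f : V → ℝ) (C : ℝ) (h : ∀ x, |f x| ≤ C) : BoundedFun V :=
  ⟨f, memℓp_infty ⟨C, by rintro _ ⟨x, rfl⟩; exact h x⟩⟩

/-- Evaluation at a point as a character of the algebra of bounded functions. -/
noncomputable def eval (x : V) : BoundedFun V →A[ℝ] ℝ where
  toFun f := f x
  map_one' := rfl
  map_mul' _ _ := rfl
  map_zero' := rfl
  map_add' _ _ := rfl
  commutes' c := by
    rw [Algebra.algebraMap_eq_smul_one]
    exact mul_one c
  cont := (lp.evalCLM ℝ (fun _ : V => ℝ) ⊤ x).continuous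

theorem eval_apply (x : V) (f : BoundedFun V) : eval x f = f x := rfl

end BoundedFun

theorem exists_boundedLap {w : V → V → ℝ} {m : V → ℝ} (hnonneg : ∀ x y, 0 ≤ w x y)
    (hm : ∀ x, 0 < m x) (hlocfin : ∀ x, Summable fun y => w x y)
    {D : ℝ} (hD0 : 0 ≤ D) (hD : ∀ x, nDeg w m x ≤ D) :
    ∃ L : BoundedFun V →L[ℝ] BoundedFun V, ∀ f x, L f x = graphLap w m f x := by
  have hbound : ∀ (f : BoundedFun V) x, |graphLap w m f x| ≤ 2 * D * ‖f‖ := fun f x => by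
    have hmx := hm x
    have hb : ∀ y, ‖w x y * (f y - f x)‖ ≤ w x y * (2 * ‖f‖) := fun y => by
      rw [norm_mul, Real.norm_of_nonneg (hnonneg x y)]
      refine mul_le_mul_of_nonneg_left ((abs_sub _ _).trans ?_) (hnonneg x y)
      linarith [f.abs_apply_le x, f.abs_apply_le y]
    have h := tsum_of_norm_bounded ((hlocfin x).hasSum.mul_right (2 * ‖f‖)) hb
    rw [graphLap, abs_mul, abs_of_pos (by positivity : 0 < 1 / m x)]
    calc 1 / m x * |∑' y, w x y * (f y - f x)|
        ≤ 1 / m x * ((∑' y, w x y) * (2 * ‖f‖)) := by gcongr; exact h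
      _ = nDeg w m x * (2 * ‖f‖) := by rw [nDeg, vertexDeg]; ring
      _ ≤ D * (2 * ‖f‖) := by gcongr; exact hD x
      _ = _ := by ring
  let T : BoundedFun V →ₗ[ℝ] BoundedFun V :=
    { toFun := fun f => BoundedFun.ofBound (graphLap w m f) _ (hbound f)
      map_add' := fun f g => by
        ext x
        change graphLap w m (fun y => f y + g y) x = graphLap w m f x + graphLap w m g x
        simp only [graphLap]
        rw [← mul_add, ← (summable_weight_mul_sub hnonneg hlocfin f.abs_apply_le x).tsum_add
          (summable_weight_mul_sub hnonneg hlocfin g.abs_apply_le x)]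
        exact congrArg _ (tsum_congr fun y => by ring)
      map_smul' := fun c f => by
        ext x
        change graphLap w m (fun y => c * f y) x = c * graphLap w m f x
        simp only [graphLap]
        rw [mul_left_comm c, ← tsum_mul_left (a := c)]
        exact congrArg _ (tsum_congr fun y => by ring) }
  refine ⟨T.mkContinuous (2 * D) fun f =>
    lp.norm_le_of_forall_le (by positivity) (hbound f), fun f x => rfl⟩

variable {w : V → V → ℝ} {m : V → ℝ} {L : BoundedFun V →L[ℝ] BoundedFun V}

theorem coe_boundedGamma (hL : ∀ f x, L f x = graphLap w m f x) (f g : BoundedFun V) (x : V) :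
    boundedGamma L f g x = bakryGamma w m f g x := by
  change (1 / 2 : ℝ) * (L (f * g) x - f x * L g x - g x * L f x) = _
  rw [hL, hL, hL, bakryGamma, lp.infty_coeFn_mul]
  exact (one_div_mul_eq_div _ _)

theorem coe_boundedGamma2 (hL : ∀ f x, L f x = graphLap w m f x) (f g : BoundedFun V) (x : V) :
    boundedGamma2 L f g x = bakryGamma2 w m f g x := by
  change (1 / 2 : ℝ) * (L (boundedGamma L f g) x - boundedGamma L f (L g) x
    - boundedGamma L g (L f) x) = _
  have hΓ : ∀ f g : BoundedFun V, ⇑(boundedGamma L f g) = bakryGamma w m f g :=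
    fun f g => funext (coe_boundedGamma hL f g)
  have hL' : ∀ f : BoundedFun V, ⇑(L f) = graphLap w m f := fun f => funext (hL f)
  rw [hL', hΓ, hΓ, hΓ, hL', hL', bakryGamma2]
  exact (one_div_mul_eq_div _ _)

/-- Under `CD(K,n)` with bounded degree, the heat flow of a bounded function with `Γ f ≤ 1`
becomes constant along walks. -/
theorem tendsto_sub_of_isWalk (hnonneg : ∀ x y, 0 ≤ w x y) (hm : ∀ x, 0 < m x)
    (hlocfin : ∀ x, Summable fun y => w x y) {K : ℝ} (hK : 0 < K) {h : ℝ → BoundedFun V}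
    (hh : ∀ t, 0 ≤ t → ∀ x, bakryGamma w m (h t) (h t) x ≤ Real.exp (-2 * K * t))
    {x y : V} {k : ℕ} {p : ℕ → V} (hp : IsWalk w x y k p) :
    Tendsto (fun t => h t y - h t x) atTop (nhds 0) := by
  obtain ⟨rfl, rfl, hp⟩ := hp
  have hedge : ∀ a b, 0 < w a b → Tendsto (fun t => h t b - h t a) atTop (nhds 0) := by
    intro a b hab
    have hexp : Tendsto (fun t : ℝ => Real.exp (-2 * K * t)) atTop (nhds 0) := by
      refine Real.tendsto_exp_atBot.comp (tendsto_id.const_mul_atTop_of_neg ?_)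
      linarith
    have hsq : Tendsto (fun t => (h t b - h t a) ^ 2) atTop (nhds 0) := by
      refine tendsto_of_tendsto_of_tendsto_of_le_of_le' tendsto_const_nhds
        (by simpa only [mul_zero] using hexp.const_mul (2 * m a / w a b))
        (Eventually.of_forall fun t => sq_nonneg _) ?_
      filter_upwards [eventually_ge_atTop 0] with t ht
      exact sq_sub_le_of_bakryGamma_le hnonneg hm hlocfin (h t).abs_apply_le hab (hh t ht a)
    rw [tendsto_zero_iff_abs_tendsto_zero]
    simpa [Function.comp_def, Real.sqrt_sq_eq_abs] using hsq.sqrt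
  have hstep : ∀ i ≤ k, Tendsto (fun t => h t (p i) - h t (p 0)) atTop (nhds 0) := by
    intro i
    induction i with
    | zero => intro _; simp
    | succ i ih =>
      intro hi
      have := (hedge _ _ (hp i hi)).add (ih (Nat.le_of_succ_le hi))
      simpa using this
  exact hstep k le_rfl

theorem abs_sub_le_of_CD (hnonneg : ∀ x y, 0 ≤ w x y) (hm : ∀ x, 0 < m x)
    (hlocfin : ∀ x, Summable fun y => w x y) (hconn : GraphConnected w)
    (hDegmax : BddAbove (Set.range fun x : V => nDeg w m x))
    {K n : ℝ} (hK : 0 < K) (hn : 0 < n) (hCD : CDCond w m K n)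
    {x₀ y₀ : V} (hxy : x₀ ≠ y₀) (f : BoundedFun V) (hf : ∀ z, bakryGamma w m f f z ≤ 1) :
    |f y₀ - f x₀| ≤ √(n / K) *
        (Real.arcsin (1 / √(K * n / (2 * nDeg w m x₀) + 1)) +
          Real.arcsin (1 / √(K * n / (2 * nDeg w m y₀) + 1))) := by
  obtain ⟨D, hD⟩ := hDegmax
  have hD' : ∀ x, nDeg w m x ≤ D := fun x => hD ⟨x, rfl⟩
  have hdx := nDeg_pos hnonneg hm hlocfin hconn hxy
  have hdy := nDeg_pos hnonneg hm hlocfin hconn hxy.symm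
  obtain ⟨L, hL⟩ := exists_boundedLap hnonneg hm hlocfin (hdx.le.trans (hD' x₀)) hD'
  have hpos : ∀ f : BoundedFun V, (∀ x, 0 ≤ BoundedFun.eval x f) →
      ∀ x, 0 ≤ BoundedFun.eval x (L f) + D * BoundedFun.eval x f := by
    intro f hf x
    simp only [BoundedFun.eval_apply] at hf ⊢
    rw [hL, graphLap_eq m hnonneg hlocfin f.abs_apply_le]
    have h1 : 0 ≤ 1 / m x * ∑' y, w x y * f y :=
      mul_nonneg (one_div_nonneg.2 (hm x).le)
        (tsum_nonneg fun y => mul_nonneg (hnonneg x y) (hf y))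
    have h2 := mul_le_mul_of_nonneg_right (hD' x) (hf x)
    linarith
  have hL1 : L 1 = 0 := by
    ext x
    rw [hL, graphLap]
    simp
  have hCD' : ∀ (f : BoundedFun V) x, (1 / n) * (BoundedFun.eval x (L f)) ^ 2
      + K * BoundedFun.eval x (boundedGamma L f f) ≤ BoundedFun.eval x (boundedGamma2 L f f) := by
    intro f x
    simp only [BoundedFun.eval_apply, coe_boundedGamma hL, coe_boundedGamma2 hL, hL]
    exact hCD f x
  have hf' : ∀ x, BoundedFun.eval x (boundedGamma L f f) ≤ 1 := fun x => by
    rw [BoundedFun.eval_apply, coe_boundedGamma hL]; exact hf x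
  have hsq : ∀ x, 0 < nDeg w m x → ∀ f : BoundedFun V, (BoundedFun.eval x (L f)) ^ 2
      ≤ 2 * nDeg w m x * BoundedFun.eval x (boundedGamma L f f) := fun x hx f => by
    rw [BoundedFun.eval_apply, BoundedFun.eval_apply, coe_boundedGamma hL, hL]
    exact sq_graphLap_le hnonneg hm hlocfin f.abs_apply_le hx
  have hosc : ∀ x, 0 < nDeg w m x → ∀ t, 0 ≤ t → |heatSemigroup L t f x - f x|
      ≤ √(n / K) * Real.arcsin (1 / √(K * n / (2 * nDeg w m x) + 1)) := fun x hx t ht =>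
    abs_heatSemigroup_sub_le BoundedFun.eval hpos hL1 hK hn hCD' hx (hsq x hx) ht hf'
  have hdecay : ∀ t, 0 ≤ t → ∀ x, bakryGamma w m (heatSemigroup L t f) (heatSemigroup L t f) x
      ≤ Real.exp (-2 * K * t) := fun t ht x => by
    have h := heatSemigroup_apply_le_exp BoundedFun.eval hpos hL1 hK hn hCD' ht hf' x
    rw [BoundedFun.eval_apply, coe_boundedGamma hL] at h
    have hexp : Real.exp (-2 * K * t) ≤ 1 := Real.exp_le_one_iff.2 (by nlinarith)
    have h2 : 0 ≤ (1 - Real.exp (-2 * K * t)) / (K * n) *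
        (BoundedFun.eval x (L (heatSemigroup L t f))) ^ 2 :=
      mul_nonneg (div_nonneg (by linarith) (by positivity)) (sq_nonneg _)
    linarith
  obtain ⟨k, p, hp⟩ := hconn x₀ y₀
  have hlim := (tendsto_sub_of_isWalk hnonneg hm hlocfin hK hdecay hp).abs
  rw [abs_zero] at hlim
  have hlim' := hlim.add_const (√(n / K) *
        (Real.arcsin (1 / √(K * n / (2 * nDeg w m x₀) + 1)) +
          Real.arcsin (1 / √(K * n / (2 * nDeg w m y₀) + 1))))
  rw [zero_add] at hlim'
  refine ge_of_tendsto hlim' ?_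
  filter_upwards [eventually_ge_atTop 0] with t ht
  have hx := hosc x₀ hdx t ht
  have hy := hosc y₀ hdy t ht
  rw [abs_sub_comm] at hy
  have e : f y₀ - f x₀ = (heatSemigroup L t f y₀ - heatSemigroup L t f x₀)
      + (heatSemigroup L t f x₀ - f x₀) + (f y₀ - heatSemigroup L t f y₀) := by ring
  rw [e, mul_add]
  exact (abs_add_three _ _ _).trans (by linarith)

end WeightedGraph

theorem resistDist_le_of_CD [Countable V]
    (w : V → V → ℝ) (m : V → ℝ)
    (hsymm : ∀ x y, w x y = w y x) (hnonneg : ∀ x y, 0 ≤ w x y)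
    (hdiag : ∀ x, w x x = 0) (hm : ∀ x, 0 < m x)
    (hlocfin : ∀ x, Summable fun y => w x y)
    (hconn : GraphConnected w)
    (hcomplete : GraphComplete w m)
    (hnondeg : NondegMeasure m)
    (hDegmax : BddAbove (Set.range fun x : V => nDeg w m x))
    (K n : ℝ) (hK : 0 < K) (hn : 0 < n) (hCD : CDCond w m K n)
    (x₀ y₀ : V) :
    resistDist w m x₀ y₀ ≤
      Real.sqrt (n / K) *
        (Real.arcsin (1 / Real.sqrt (K * n / (2 * nDeg w m x₀) + 1)) +
          Real.arcsin (1 / Real.sqrt (K * n / (2 * nDeg w m y₀) + 1))) := by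
  have hR : 0 ≤ √(n / K) *
      (Real.arcsin (1 / √(K * n / (2 * nDeg w m x₀) + 1)) +
        Real.arcsin (1 / √(K * n / (2 * nDeg w m y₀) + 1))) :=
    mul_nonneg (Real.sqrt_nonneg _) (add_nonneg (Real.arcsin_nonneg.2 (by positivity))
      (Real.arcsin_nonneg.2 (by positivity)))
  refine Real.sSup_le ?_ hR
  rintro _ ⟨f, hf, rfl⟩
  rcases eq_or_ne x₀ y₀ with rfl | hxy
  · simpa using hR
  set M := |f x₀| + |f y₀| with hM
  set g : V → ℝ := fun z => max (-M) (min M (f z)) with hg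
  have hM0 : 0 ≤ M := by positivity
  have hgM : ∀ z, |g z| ≤ M := fun z =>
    abs_le.2 ⟨le_max_left _ _, max_le (by linarith) (min_le_left _ _)⟩
  have hgf : ∀ z, |f z| ≤ M → g z = f z := fun z hz => by
    simp only [hg]
    rw [min_eq_right (abs_le.1 hz).2, max_eq_right (abs_le.1 hz).1]
  have hcontr : ∀ y z, |g y - g z| ≤ |f y - f z| := fun y z => by
    have h := abs_min_sub_min_le_max M (f y) M (f z)
    rw [sub_self, abs_zero, max_eq_right (abs_nonneg _)] at h
    exact (abs_max_sub_max_le_max _ _ _ _).trans (by simpa using h)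
  have hgΓ : ∀ z, bakryGamma w m g g z ≤ 1 := fun z =>
    bakryGamma_le_one_of_carre_le_one hnonneg hm hlocfin hgM
      ((carre_mono m hnonneg fun y => hcontr y z).trans (hf z))
  rw [← hgf y₀ (by linarith [abs_nonneg (f x₀)]), ← hgf x₀ (by linarith [abs_nonneg (f y₀)])]
  exact abs_sub_le_of_CD hnonneg hm hlocfin hconn hDegmax hK hn hCD hxy
    (BoundedFun.ofBound g M hgM) hgΓ
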